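/- With the notation of the context (in particular n ≥ 2), the signed measure ψ^{(0,1)} equals the pushforward under the map t ↦ tⁿ of the signed measure with density tⁿ/(y₁²⋯y_n²) with respect to ψ; equivalently, dψ^{(0,1)}(t) = (t/(y₁²⋯y_n²)) dψ(t^{1/n}). -/

import Mathlib

open MeasureTheory
open scoped ENNReal

noncomputable section

/-- The `j`-th moment `γ_j(ν) := ∫ t^j dν(t)`. -/
noncomputable def mom (ν : MeasureTheory.Measure ℝ) (j : ℕ) : ℝ := ∫ t, t ^ j ∂ν

/-- The weights `w_j(ν) := (γ_{j+1}(ν)/γ_j(ν))^{1/2}` of the subnormal unilateral weighted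
shift whose Berger measure is `ν`. -/
noncomputable def wgt (ν : MeasureTheory.Measure ℝ) (j : ℕ) : ℝ :=
  Real.sqrt (mom ν (j + 1) / mom ν j)

/-- `ν_{(n,i)}`: the pushforward under `t ↦ tⁿ` of the measure `(t^i/γ_i(ν)) dν(t)`. -/
noncomputable def nuPow (ν : MeasureTheory.Measure ℝ) (n i : ℕ) : MeasureTheory.Measure ℝ :=
  (ν.withDensity fun t => ENNReal.ofReal (t ^ i / mom ν i)).map fun t => t ^ n

/-- `ν₁`: the measure `(t/γ₁(ν)) dν(t)`. -/
noncomputable def nuOne (ν : MeasureTheory.Measure ℝ) : MeasureTheory.Measure ℝ :=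
  ν.withDensity fun t => ENNReal.ofReal (t / mom ν 1)

/-- `∫ (1/t) dμ(t)`, as an extended real (`(0 : ℝ≥0∞)⁻¹ = ∞`). -/
noncomputable def invInt (μ : MeasureTheory.Measure ℝ) : ℝ≥0∞ :=
  ∫⁻ t, (ENNReal.ofReal t)⁻¹ ∂μ

lemma map_withDensity_comp {ν : Measure ℝ} {f : ℝ → ℝ} (hf : Measurable f) {g : ℝ → ℝ≥0∞}
    (hg : Measurable g) : (ν.map f).withDensity g = (ν.withDensity (g ∘ f)).map f := by
  ext s hs
  rw [withDensity_apply _ hs, Measure.map_apply hf hs, withDensity_apply _ (hf hs),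
    setLIntegral_map hs hg hf]
  rfl

lemma ae_nonneg_of_measure_Iio_eq_zero {ν : Measure ℝ} (h : ν (Set.Iio 0) = 0) :
    ∀ᵐ t ∂ν, 0 ≤ t := by
  simp only [ae_iff, not_le]
  exact h

lemma mom_nuPow_one {ν : Measure ℝ} (h : ν (Set.Iio 0) = 0) (hm : ∀ j, 0 < mom ν j) (n i : ℕ) :
    mom (nuPow ν n i) 1 = mom ν (n + i) / mom ν i := by
  rw [mom, nuPow, integral_map (by fun_prop) (by fun_prop),
    integral_withDensity_eq_integral_toReal_smul (by fun_prop) (by simp),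
    show mom ν (n + i) = ∫ t, t ^ (n + i) ∂ν from rfl, ← integral_div]
  refine integral_congr_ae ?_
  filter_upwards [ae_nonneg_of_measure_Iio_eq_zero h] with t ht
  have := hm i
  rw [ENNReal.toReal_ofReal (by positivity), smul_eq_mul]
  ring

lemma nuOne_nuPow {ν : Measure ℝ} (h : ν (Set.Iio 0) = 0) (hm : ∀ j, 0 < mom ν j) (n i : ℕ) :
    nuOne (nuPow ν n i) =
      (ν.withDensity fun t => ENNReal.ofReal (t ^ (n + i) / mom ν (n + i))).map
        fun t => t ^ n := by
  rw [nuOne, mom_nuPow_one h hm, nuPow, map_withDensity_comp (by fun_prop) (by fun_prop),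
    ← withDensity_mul _ (by fun_prop) (by fun_prop)]
  congr 1
  refine withDensity_congr_ae ?_
  filter_upwards [ae_nonneg_of_measure_Iio_eq_zero h] with t ht
  have hi := hm i
  have hni := hm (n + i)
  simp only [Pi.mul_apply, Function.comp_apply]
  rw [← ENNReal.ofReal_mul (by positivity)]
  congr 1
  field_simp
  ring

lemma prod_wgt_sq {ν : Measure ℝ} (hm : ∀ j, 0 < mom ν j) (n k : ℕ) :
    ∏ j ∈ Finset.range n, wgt ν (j + k) ^ 2 = mom ν (n + k) / mom ν k := by
  induction n with
  | zero => simp [(hm k).ne']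
  | succ n ih =>
    have h₀ := hm k
    have h₁ := hm (n + k)
    have h₂ := hm (n + k + 1)
    rw [Finset.prod_range_succ, ih, wgt, Real.sq_sqrt (by positivity), Nat.add_right_comm n 1 k]
    field_simp

lemma nuOne_withDensity_pow {ν : Measure ℝ} (h : ν (Set.Iio 0) = 0) (hm : ∀ j, 0 < mom ν j)
    (n : ℕ) :
    ((nuOne ν).withDensity fun t => ENNReal.ofReal (t ^ n / (mom ν (n + 1) / mom ν 1))) =
      ν.withDensity fun t => ENNReal.ofReal (t ^ (n + 1) / mom ν (n + 1)) := by
  rw [nuOne, ← withDensity_mul _ (by fun_prop) (by fun_prop)]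
  refine withDensity_congr_ae ?_
  filter_upwards [ae_nonneg_of_measure_Iio_eq_zero h] with t ht
  have h₁ := hm 1
  have hn := hm (n + 1)
  simp only [Pi.mul_apply]
  rw [← ENNReal.ofReal_mul (by positivity)]
  congr 1
  field_simp
  ring

lemma smul_map_withDensity_ofReal {ν : Measure ℝ} {f g : ℝ → ℝ} (hg : Measurable g)
    {b c p : ℝ} (hb : 0 ≤ b) (hc : 0 < c) (hp : 0 < p) (I : ℝ≥0∞) :
    (ENNReal.ofReal (b * c / p) * I) •
        (ν.withDensity fun t => ENNReal.ofReal (g t / c)).map f =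
      (ENNReal.ofReal b * I) • (ν.withDensity fun t => ENNReal.ofReal (g t / p)).map f := by
  have key : (ν.withDensity fun t => ENNReal.ofReal (g t / p)) =
      ENNReal.ofReal (c / p) • ν.withDensity fun t => ENNReal.ofReal (g t / c) := by
    rw [← withDensity_smul _ (by fun_prop)]
    congr 1
    ext t
    rw [Pi.smul_apply, smul_eq_mul, ← ENNReal.ofReal_mul (by positivity)]
    congr 1
    field_simp
  rw [key, Measure.map_smul, smul_smul, mul_div_assoc, ENNReal.ofReal_mul hb]
  congr 1
  ring

/-- The identity `dψ^{(0,1)}(t) = (t/(y₁²⋯y_n²)) dψ(t^{1/n})`: the signed measure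
`ψ^{(0,1)} = (τ_{(n,1)})₁ − (a²z₀²⋯z_{n−1}²/(y₁²⋯y_n²))‖1/s‖_{L¹(ξ)}·(η_{(n,0)})₁`
equals the pushforward under `t ↦ tⁿ` of the signed measure with density
`tⁿ/(y₁²⋯y_n²)` with respect to `ψ = τ₁ − a²‖1/s‖_{L¹(ξ)}·η`.  (Equality of the signed
measures `P₁ − P₂ = Q₁ − Q₂` is expressed as `P₁ + Q₂ = Q₁ + P₂`.) -/
theorem psi01_eq_pushforward_of_psi
    (τ ξ η : Measure ℝ)
    [IsProbabilityMeasure τ] [IsProbabilityMeasure ξ] [IsProbabilityMeasure η]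
    (hτ0 : τ (Set.Iio 0) = 0) (hξ0 : ξ (Set.Iio 0) = 0) (hη0 : η (Set.Iio 0) = 0)
    (hτc : ∃ R : ℝ, τ (Set.Ioi R) = 0) (hξc : ∃ R : ℝ, ξ (Set.Ioi R) = 0)
    (hηc : ∃ R : ℝ, η (Set.Ioi R) = 0)
    (hτm : ∀ j, 0 < mom τ j) (hξm : ∀ j, 0 < mom ξ j) (hηm : ∀ j, 0 < mom η j)
    (a : ℝ) (ha : 0 < a) (n : ℕ) (hn : 2 ≤ n)
    (hξfin : invInt ξ ≠ ⊤) (hηfin : invInt η ≠ ⊤) :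
    nuOne (nuPow τ n 1) +
      (ENNReal.ofReal (a ^ 2) * invInt ξ) •
        ((η.withDensity fun t =>
          ENNReal.ofReal (t ^ n / ∏ j ∈ Finset.range n, wgt τ (j + 1) ^ 2)).map
            fun t => t ^ n) =
    ((nuOne τ).withDensity fun t =>
        ENNReal.ofReal (t ^ n / ∏ j ∈ Finset.range n, wgt τ (j + 1) ^ 2)).map
          (fun t => t ^ n) +
      (ENNReal.ofReal (a ^ 2 * (∏ j ∈ Finset.range n, wgt η j ^ 2) /
          (∏ j ∈ Finset.range n, wgt τ (j + 1) ^ 2)) * invInt ξ) •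
        nuOne (nuPow η n 0) := by
  have hz : ∏ j ∈ Finset.range n, wgt η j ^ 2 = mom η n := by
    simpa [mom] using prod_wgt_sq hηm n 0
  have h₁ := hτm 1
  have hn₁ := hτm (n + 1)
  rw [prod_wgt_sq hτm n 1, hz, nuOne_nuPow hτ0 hτm, nuOne_nuPow hη0 hηm,
    nuOne_withDensity_pow hτ0 hτm, add_zero,
    smul_map_withDensity_ofReal (by fun_prop) (sq_nonneg a) (hηm n) (by positivity)]

end
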